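/- Contamination lemma on the torus: let G_t be a D-dimensional torus graph with every dimension at least 5, and let ψ be a lossless translation on G_t. If for some vertex v1 the difference ψ(v1) − v1 equals a Dirac vector e_j (the standard basis vector of dimension j, modulo the torus dimensions), then ψ(v) = v + e_j for every vertex v. -/

import Mathlib

open Finset

def IsTransformation {V : Type*} (φ : V → Option V) : Prop :=
  ∀ v1 v2 w : V, φ v1 = some w → φ v2 = some w → v1 = v2

def IsEC {V : Type*} (G : SimpleGraph V) (φ : V → Option V) : Prop :=
  ∀ v w : V, φ v = some w → G.Adj v w

def IsSNP {V : Type*} (G : SimpleGraph V) (φ : V → Option V) : Prop :=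
  ∀ v1 v2 w1 w2 : V, φ v1 = some w1 → φ v2 = some w2 → (G.Adj v1 v2 ↔ G.Adj w1 w2)

def IsTranslation {V : Type*} (G : SimpleGraph V) (φ : V → Option V) : Prop :=
  IsTransformation φ ∧ IsEC G φ ∧ IsSNP G φ

def loss {V : Type*} [Fintype V] [DecidableEq V] (φ : V → Option V) : ℕ :=
  (Finset.univ.filter (fun v => φ v = none)).card

def Prec {V : Type*} [Fintype V] [DecidableEq V] (φ1 φ2 : V → Option V) : Prop :=
  loss φ2 < loss φ1 ∧ ∃ v w : V, φ1 v = some w ∧ φ2 v = some w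

def IsMinimalTranslation {V : Type*} [Fintype V] [DecidableEq V]
    (G : SimpleGraph V) (φ : V → Option V) : Prop :=
  IsTranslation G φ ∧ ∀ φ2 : V → Option V, IsTranslation G φ2 → ¬ Prec φ φ2

def torusDirac (D : ℕ) (d : Fin D → ℕ) (j : Fin D) : ∀ i, ZMod (d i) :=
  fun i => if i = j then 1 else 0

def torusGraph (D : ℕ) (d : Fin D → ℕ) : SimpleGraph (∀ i, ZMod (d i)) :=
  SimpleGraph.fromRel (fun v w => ∃ j, w = v + torusDirac D d j)

theorem ZMod.small_natCast_ne_zero {n : ℕ} (hn : 5 ≤ n) {k : ℕ} (hk : 0 < k) (hk' : k < 5) :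
    (k : ZMod n) ≠ 0 := by
  rw [Ne, ZMod.natCast_eq_zero_iff]
  intro h
  have := Nat.le_of_dvd hk h
  omega

/-- The signed Dirac vectors, i.e. the differences of adjacent vertices of the torus. -/
def IsSignedDirac (D : ℕ) (d : Fin D → ℕ) (u : ∀ i, ZMod (d i)) : Prop :=
  ∃ i, u = torusDirac D d i ∨ u = -torusDirac D d i

section

variable {D : ℕ} {d : Fin D → ℕ}

theorem torusDirac_self (i : Fin D) : torusDirac D d i i = 1 := by simp [torusDirac]

theorem torusDirac_of_ne {i k : Fin D} (h : i ≠ k) : torusDirac D d k i = 0 := by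
  simp [torusDirac, h]

theorem IsSignedDirac.neg {u : ∀ i, ZMod (d i)} (hu : IsSignedDirac D d u) :
    IsSignedDirac D d (-u) := by
  obtain ⟨i, rfl | rfl⟩ := hu
  · exact ⟨i, Or.inr rfl⟩
  · exact ⟨i, Or.inl (neg_neg _)⟩

theorem IsSignedDirac.exists_mul_ne_zero (hd : ∀ i, 5 ≤ d i) {u : ∀ i, ZMod (d i)}
    (hu : IsSignedDirac D d u) : ∃ i, ∀ k : ℕ, 0 < k → k < 5 → (k : ZMod (d i)) * u i ≠ 0 := by
  obtain ⟨i, hi⟩ := hu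
  refine ⟨i, fun k hk hk' => ?_⟩
  have := ZMod.small_natCast_ne_zero (hd i) hk hk'
  rcases hi with rfl | rfl <;> simpa [torusDirac_self] using this

theorem IsSignedDirac.apply_eq_zero_or {u a : ∀ i, ZMod (d i)} (hu : IsSignedDirac D d u)
    (ha : IsSignedDirac D d a) {i : Fin D} (hi : a i ≠ 0) : u i = 0 ∨ u = a ∨ u = -a := by
  obtain ⟨k, hk⟩ := hu
  obtain ⟨l, hl⟩ := ha
  have hil : i = l := by
    by_contra h
    rcases hl with rfl | rfl <;> simp [torusDirac_of_ne h] at hi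
  subst hil
  by_cases h : i = k
  · subst h
    right
    rcases hk with rfl | rfl <;> rcases hl with rfl | rfl <;> simp
  · left
    rcases hk with rfl | rfl <;> simp [torusDirac_of_ne h]

theorem IsSignedDirac.ne_neg_self (hd : ∀ i, 5 ≤ d i) {u : ∀ i, ZMod (d i)}
    (hu : IsSignedDirac D d u) : u ≠ -u := by
  obtain ⟨i, h⟩ := hu.exists_mul_ne_zero hd
  intro e
  have e' := congrFun e i
  rw [Pi.neg_apply] at e'
  refine h 2 (by norm_num) (by norm_num) ?_
  push_cast
  linear_combination e'

theorem torusDirac_injective (hd : ∀ i, 5 ≤ d i) : Function.Injective (torusDirac D d) := by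
  intro i k h
  by_contra hne
  have h1 := ZMod.small_natCast_ne_zero (hd i) (k := 1) (by norm_num) (by norm_num)
  have := congrFun h i
  rw [torusDirac_self, torusDirac_of_ne hne] at this
  simp [this] at h1

theorem torusDirac_ne_neg (hd : ∀ i, 5 ≤ d i) (i k : Fin D) :
    torusDirac D d i ≠ -torusDirac D d k := by
  intro h
  by_cases hik : i = k
  · subst hik
    exact IsSignedDirac.ne_neg_self hd ⟨i, Or.inl rfl⟩ h
  have h1 := ZMod.small_natCast_ne_zero (hd i) (k := 1) (by norm_num) (by norm_num)
  have := congrFun h i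
  rw [Pi.neg_apply, torusDirac_self, torusDirac_of_ne hik] at this
  simp [this] at h1

theorem torusGraph_adj_iff (hd : ∀ i, 5 ≤ d i) {v w : ∀ i, ZMod (d i)} :
    (torusGraph D d).Adj v w ↔ IsSignedDirac D d (w - v) := by
  rw [torusGraph, SimpleGraph.fromRel_adj]
  constructor
  · rintro ⟨-, ⟨k, rfl⟩ | ⟨k, rfl⟩⟩
    · exact ⟨k, Or.inl (by abel)⟩
    · exact ⟨k, Or.inr (by abel)⟩
  · intro h
    refine ⟨?_, ?_⟩
    · rintro rfl
      exact h.ne_neg_self hd (by simp)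
    · obtain ⟨k, hk | hk⟩ := h
      · exact Or.inl ⟨k, by rw [← hk]; abel⟩
      · exact Or.inr ⟨k, by rw [← neg_neg (torusDirac D d k), ← hk]; abel⟩

/-- Two signed Dirac vectors with nonzero sum are determined by this sum. -/
theorem IsSignedDirac.eq_or_eq_or_eq_neg (hd : ∀ i, 5 ≤ d i) {a b c e : ∀ i, ZMod (d i)}
    (ha : IsSignedDirac D d a) (hb : IsSignedDirac D d b) (hc : IsSignedDirac D d c)
    (he : IsSignedDirac D d e) (h : a + b = c + e) : b = e ∨ a = e ∨ b = -a := by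
  by_contra! hne
  obtain ⟨hbe, hae, hba⟩ := hne
  have hac : a ≠ c := by
    rintro rfl
    exact hbe (add_left_cancel h)
  obtain ⟨i, hi⟩ := ha.exists_mul_ne_zero hd
  have h1 := hi 1 (by norm_num) (by norm_num)
  have h2 := hi 2 (by norm_num) (by norm_num)
  have h3 := hi 3 (by norm_num) (by norm_num)
  have h4 := hi 4 (by norm_num) (by norm_num)
  push_cast at h1 h2 h3 h4
  rw [one_mul] at h1
  have hb' : b i = 0 ∨ b i = a i := by
    rcases hb.apply_eq_zero_or ha h1 with h | h | h
    · exact Or.inl h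
    · exact Or.inr (congrFun h i)
    · exact absurd h hba
  have hc' : c i = 0 ∨ c i = -a i := by
    rcases hc.apply_eq_zero_or ha h1 with h | h | h
    · exact Or.inl h
    · exact absurd h.symm hac
    · exact Or.inr (congrFun h i)
  have he' : e i = 0 ∨ e i = -a i := by
    rcases he.apply_eq_zero_or ha h1 with h | h | h
    · exact Or.inl h
    · exact absurd h.symm hae
    · exact Or.inr (congrFun h i)
  have hsum : a i + b i = c i + e i := congrFun h i
  clear hbe hae hba hac h ha hb hc he hi
  grind

variable {ψ : (∀ i, ZMod (d i)) → (∀ i, ZMod (d i))}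

theorem translation_step_cases (hd : ∀ i, 5 ≤ d i)
    (hEC : ∀ v, (torusGraph D d).Adj v (ψ v))
    (hSNP : ∀ v w, (torusGraph D d).Adj v w ↔ (torusGraph D d).Adj (ψ v) (ψ w))
    {j : Fin D} {v a : ∀ i, ZMod (d i)} (hv : ψ v = v + torusDirac D d j)
    (ha : IsSignedDirac D d a) :
    ψ (v + a) = v + a + torusDirac D d j ∨ a = torusDirac D d j ∨ ψ (v + a) = v := by
  have hb := (torusGraph_adj_iff hd).1 (hEC (v + a))
  have hc := (torusGraph_adj_iff hd).1
    ((hSNP v (v + a)).1 ((torusGraph_adj_iff hd).2 (by simpa using ha)))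
  rcases ha.eq_or_eq_or_eq_neg hd hb hc ⟨j, Or.inl rfl⟩ (by rw [hv]; abel) with h | h | h
  · exact Or.inl (by rw [← h]; abel)
  · exact Or.inr (Or.inl h)
  · refine Or.inr (Or.inr ?_)
    rw [sub_eq_iff_eq_add] at h
    rw [h]
    abel

theorem translation_sub_dirac (hd : ∀ i, 5 ≤ d i) (hbij : Function.Bijective ψ)
    (hEC : ∀ v, (torusGraph D d).Adj v (ψ v))
    (hSNP : ∀ v w, (torusGraph D d).Adj v w ↔ (torusGraph D d).Adj (ψ v) (ψ w))
    {j : Fin D} {v : ∀ i, ZMod (d i)} (hv : ψ v = v + torusDirac D d j) (i : Fin D) :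
    ψ (v - torusDirac D d i) = v - torusDirac D d i + torusDirac D d j := by
  have hi : IsSignedDirac D d (torusDirac D d i) := ⟨i, Or.inl rfl⟩
  have hback := translation_step_cases hd hEC hSNP hv hi.neg
  rw [← sub_eq_add_neg] at hback
  rcases hback with h | h | h
  · exact h
  · exact absurd h.symm (torusDirac_ne_neg hd j i)
  by_cases hij : i = j
  · rw [h, hij]
    abel
  exfalso
  have hforth : ψ (v + torusDirac D d i) = v + torusDirac D d i + torusDirac D d j := by
    rcases translation_step_cases hd hEC hSNP hv hi with h' | h' | h'
    · exact h'
    · exact absurd (torusDirac_injective hd h') hij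
    · have := hbij.1 (h'.trans h.symm)
      rw [sub_eq_add_neg] at this
      exact absurd (add_left_cancel this) (hi.ne_neg_self hd)
  -- The images of `v ± e_i` have two common neighbours, but `v ± e_i` have only one.
  obtain ⟨u, hu⟩ := hbij.2 (v + torusDirac D d i)
  have hx := (torusGraph_adj_iff hd).1 ((hSNP (v - torusDirac D d i) u).2
    ((torusGraph_adj_iff hd).2 (by rw [h, hu]; simpa using hi)))
  have hy := (torusGraph_adj_iff hd).1 ((hSNP (v + torusDirac D d i) u).2
    ((torusGraph_adj_iff hd).2 (by
      rw [hforth, hu]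
      exact ⟨j, Or.inr (by abel)⟩)))
  have huv : u = v := by
    rcases hi.eq_or_eq_or_eq_neg hd hy hx hi.neg (by abel) with h' | h' | h'
    · rw [sub_eq_iff_eq_add] at h'
      rw [h']
      abel
    · exact absurd h' (hi.ne_neg_self hd)
    · rw [sub_eq_iff_eq_add] at h'
      rw [h']
      abel
  rw [huv, hv] at hu
  exact hij (torusDirac_injective hd (add_left_cancel hu)).symm

/-- A set of torus vertices closed under subtracting Dirac vectors is everything. -/
theorem torus_induction (hd : ∀ i, 5 ≤ d i) {P : (∀ i, ZMod (d i)) → Prop}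
    (hstep : ∀ v, P v → ∀ i, P (v - torusDirac D d i)) {v₁ : ∀ i, ZMod (d i)} (h₁ : P v₁)
    (v : ∀ i, ZMod (d i)) : P v := by
  have hmul (i : Fin D) (n : ℕ) (w : ∀ i, ZMod (d i)) (hw : P w) :
      P (w - n • torusDirac D d i) := by
    induction n with
    | zero => simpa using hw
    | succ n ih =>
      rw [succ_nsmul, ← sub_sub]
      exact hstep _ ih i
  have hsum (n : Fin D → ℕ) (s : Finset (Fin D)) :
      P (v₁ - ∑ i ∈ s, n i • torusDirac D d i) := by
    induction s using Finset.induction_on with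
    | empty => simpa using h₁
    | insert i s his ih =>
      rw [Finset.sum_insert his, add_comm, ← sub_sub]
      exact hmul i (n i) _ ih
  convert hsum (fun i => (v₁ i - v i).val) Finset.univ
  funext k
  have : NeZero (d k) := ⟨by have := hd k; omega⟩
  simp [torusDirac]

end

theorem stmt_15 (D : ℕ) (d : Fin D → ℕ) (hd : ∀ i, 5 ≤ d i)
    (ψ : (∀ i, ZMod (d i)) → (∀ i, ZMod (d i))) (hbij : Function.Bijective ψ)
    (hEC : ∀ v, (torusGraph D d).Adj v (ψ v))
    (hSNP : ∀ v w, (torusGraph D d).Adj v w ↔ (torusGraph D d).Adj (ψ v) (ψ w))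
    (j : Fin D) (v1 : ∀ i, ZMod (d i)) (h1 : ψ v1 = v1 + torusDirac D d j) :
    ∀ v, ψ v = v + torusDirac D d j := by
  exact torus_induction hd (fun _ hv i => translation_sub_dirac hd hbij hEC hSNP hv i) h1
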